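/- Let f : [0,1]^2 → ℝ be (c,α)-mixed Hölder and fix (x,y) ∈ [0,1]^2 and m ≥ 1. Write f_k^j := f(x_k, y_j), where x_k is the center of the dyadic interval of length 2^{−k} containing x and y_j is the center of the dyadic interval of length 2^{−j} containing y. Then there is a constant C > 0 depending only on c and α such that Σ_{j=1}^{m} Σ_{k=m−j+1}^{m} |f_k^j − f_{k−1}^j − f_k^{j−1} + f_{k−1}^{j−1}| ≤ C·m·2^{−αm}; moreover each individual term satisfies |f_k^j − f_{k−1}^j − f_k^{j−1} + f_{k−1}^{j−1}| ≤ C·2^{−α(j+k)}. -/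

import Mathlib

open MeasureTheory ProbabilityTheory
open scoped RealInnerProductSpace Classical

noncomputable section

/-- The `i`-th dyadic interval at scale `k` (`0`-based); the rightmost interval
is taken closed so that the scale-`k` dyadic intervals partition `[0,1]`. -/
def dyadicI (k i : ℕ) : Set ℝ :=
  if i + 1 = 2 ^ k then Set.Icc ((i : ℝ) / 2 ^ k) (((i : ℝ) + 1) / 2 ^ k)
  else Set.Ico ((i : ℝ) / 2 ^ k) (((i : ℝ) + 1) / 2 ^ k)

/-- Index of the dyadic interval of length `2^{-k}` containing `x ∈ [0,1]`. -/
def dIdx (k : ℕ) (x : ℝ) : ℕ := min (Int.toNat ⌊x * 2 ^ k⌋) (2 ^ k - 1)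

/-- Center of the `i`-th dyadic interval at scale `k`. -/
def dCen (k i : ℕ) : ℝ := ((i : ℝ) + 1 / 2) / 2 ^ k

/-- Center of the dyadic interval of length `2^{-k}` containing `x`. -/
def dyadicCenter (k : ℕ) (x : ℝ) : ℝ := dCen k (dIdx k x)

/-- `f` is `(c,α)`-mixed Hölder on `[0,1]²`. -/
def MixedHolder (c α : ℝ) (f : ℝ × ℝ → ℝ) : Prop :=
  ∀ x ∈ Set.Icc (0:ℝ) 1, ∀ x' ∈ Set.Icc (0:ℝ) 1, ∀ y ∈ Set.Icc (0:ℝ) 1, ∀ y' ∈ Set.Icc (0:ℝ) 1,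
    |f (x', y) - f (x, y)| ≤ c * |x' - x| ^ α ∧
    |f (x, y') - f (x, y)| ≤ c * |y' - y| ^ α ∧
    |f (x', y') - f (x, y') - f (x', y) + f (x, y)| ≤ c * (|x' - x| * |y' - y|) ^ α

theorem abs_dyadicCenter_sub_le (k : ℕ) {x : ℝ} (hx : x ∈ Set.Icc (0:ℝ) 1) :
    |dyadicCenter k x - x| ≤ 1 / 2 / 2 ^ k := by
  obtain ⟨h0, h1⟩ := hx
  have hp : (0:ℝ) < 2 ^ k := by positivity
  have hx0 : 0 ≤ x * 2 ^ k := by positivity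
  have hidx : (dIdx k x : ℝ) ≤ x * 2 ^ k ∧ x * 2 ^ k ≤ dIdx k x + 1 := by
    have hd : dIdx k x = min ⌊x * 2 ^ k⌋₊ (2 ^ k - 1) := rfl
    have hfl := Nat.floor_le hx0
    have hlt := (Nat.lt_floor_add_one (x * 2 ^ k)).le
    rcases le_total ⌊x * 2 ^ k⌋₊ (2 ^ k - 1) with h | h
    · rw [hd, min_eq_left h]
      exact ⟨hfl, hlt⟩
    · rw [hd, min_eq_right h]
      have h' : ((2 ^ k - 1 : ℕ) : ℝ) ≤ ⌊x * 2 ^ k⌋₊ := by exact_mod_cast h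
      refine ⟨h'.trans hfl, ?_⟩
      rw [Nat.cast_sub Nat.one_le_two_pow]
      push_cast
      nlinarith
  have heq : dyadicCenter k x - x = (dIdx k x + 1 / 2 - x * 2 ^ k) / 2 ^ k := by
    unfold dyadicCenter dCen
    field_simp
  rw [heq, abs_div, abs_of_pos hp]
  gcongr
  rw [abs_le]
  constructor <;> linarith [hidx.1, hidx.2]

theorem dyadicCenter_mem_Icc (k : ℕ) (x : ℝ) : dyadicCenter k x ∈ Set.Icc (0:ℝ) 1 := by
  have hle : dIdx k x + 1 ≤ 2 ^ k := by
    have h : dIdx k x ≤ 2 ^ k - 1 := min_le_right _ _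
    have := Nat.one_le_two_pow (n := k)
    omega
  have hle' : (dIdx k x : ℝ) + 1 ≤ 2 ^ k := by exact_mod_cast hle
  unfold dyadicCenter dCen
  refine ⟨by positivity, ?_⟩
  rw [div_le_one (by positivity)]
  linarith

theorem abs_dyadicCenter_sub_pred_le {k : ℕ} (hk : 1 ≤ k) {x : ℝ} (hx : x ∈ Set.Icc (0:ℝ) 1) :
    |dyadicCenter k x - dyadicCenter (k - 1) x| ≤ 2 / 2 ^ k := by
  obtain ⟨n, rfl⟩ := Nat.exists_eq_add_of_le' hk
  have h₁ := abs_dyadicCenter_sub_le (n + 1) hx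
  have h₂ := abs_dyadicCenter_sub_le n hx
  rw [Nat.add_sub_cancel]
  have htri := abs_sub_le (dyadicCenter (n + 1) x) x (dyadicCenter n x)
  rw [abs_sub_comm x] at htri
  have hp : (0:ℝ) < 1 / 2 ^ (n + 1) := by positivity
  have e₁ : (1:ℝ) / 2 / 2 ^ n = 1 / 2 ^ (n + 1) := by rw [pow_succ]; field_simp
  have e₂ : (1:ℝ) / 2 / 2 ^ (n + 1) = 1 / 2 * (1 / 2 ^ (n + 1)) := by ring
  have e₃ : (2:ℝ) / 2 ^ (n + 1) = 2 * (1 / 2 ^ (n + 1)) := by ring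
  linarith

theorem MixedHolder.abs_mixed_difference_le {c α : ℝ} (hc : 0 < c) (hα : 0 < α) (hα1 : α ≤ 1)
    {f : ℝ × ℝ → ℝ} (hf : MixedHolder c α f) {j k : ℕ} (hj : 1 ≤ j) (hk : 1 ≤ k)
    {x y : ℝ} (hx : x ∈ Set.Icc (0:ℝ) 1) (hy : y ∈ Set.Icc (0:ℝ) 1) :
    |f (dyadicCenter k x, dyadicCenter j y) - f (dyadicCenter (k - 1) x, dyadicCenter j y)
        - f (dyadicCenter k x, dyadicCenter (j - 1) y)
        + f (dyadicCenter (k - 1) x, dyadicCenter (j - 1) y)| ≤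
      4 * c * (2 : ℝ) ^ (-(α * ((j : ℝ) + (k : ℝ)))) := by
  refine (hf _ (dyadicCenter_mem_Icc (k - 1) x) _ (dyadicCenter_mem_Icc k x)
    _ (dyadicCenter_mem_Icc (j - 1) y) _ (dyadicCenter_mem_Icc j y)).2.2.trans ?_
  have hprod : |dyadicCenter k x - dyadicCenter (k - 1) x| *
      |dyadicCenter j y - dyadicCenter (j - 1) y| ≤ 4 * (2 : ℝ) ^ (-((j : ℝ) + k)) := by
    refine (mul_le_mul (abs_dyadicCenter_sub_pred_le hk hx) (abs_dyadicCenter_sub_pred_le hj hy)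
      (abs_nonneg _) (by positivity)).trans_eq ?_
    rw [Real.rpow_neg two_pos.le, Real.rpow_add two_pos, Real.rpow_natCast, Real.rpow_natCast]
    field_simp
    norm_num
  have hfour : (4:ℝ) ^ α ≤ 4 := Real.rpow_le_self_of_one_le (by norm_num) hα1
  calc c * (|dyadicCenter k x - dyadicCenter (k - 1) x| *
        |dyadicCenter j y - dyadicCenter (j - 1) y|) ^ α
      ≤ c * (4 * (2 : ℝ) ^ (-((j : ℝ) + k))) ^ α := by gcongr
    _ = c * ((4:ℝ) ^ α * (2 : ℝ) ^ (-(α * ((j : ℝ) + k)))) := by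
        rw [Real.mul_rpow (by norm_num) (by positivity), ← Real.rpow_mul two_pos.le]
        ring_nf
    _ ≤ c * (4 * (2 : ℝ) ^ (-(α * ((j : ℝ) + k)))) := by gcongr
    _ = _ := by ring

theorem sum_Icc_two_rpow_le {α : ℝ} (hα : 0 < α) {j m : ℕ} (hjm : j ≤ m) :
    ∑ k ∈ Finset.Icc (m - j + 1) m, (2 : ℝ) ^ (-(α * ((j : ℝ) + (k : ℝ)))) ≤
      (1 - (2 : ℝ) ^ (-α))⁻¹ * (2 : ℝ) ^ (-(α * (m : ℝ))) := by
  have hr1 : (2 : ℝ) ^ (-α) < 1 := Real.rpow_lt_one_of_one_lt_of_neg one_lt_two (by linarith)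
  have hr0 : (0 : ℝ) ≤ (2 : ℝ) ^ (-α) := by positivity
  have hterm (i : ℕ) : (2 : ℝ) ^ (-(α * ((j : ℝ) + ((m - j + 1 + i : ℕ) : ℝ)))) ≤
      ((2 : ℝ) ^ (-α)) ^ i * (2 : ℝ) ^ (-(α * (m : ℝ))) := by
    rw [← Real.rpow_natCast, ← Real.rpow_mul two_pos.le, ← Real.rpow_add two_pos]
    refine Real.rpow_le_rpow_of_exponent_le one_le_two ?_
    push_cast [Nat.cast_sub hjm]
    linarith
  rw [← Finset.Ico_add_one_right_eq_Icc, Finset.sum_Ico_eq_sum_range]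
  refine (Finset.sum_le_sum fun i _ => hterm i).trans ?_
  rw [← Finset.sum_mul]
  gcongr
  rw [← tsum_geometric_of_lt_one hr0 hr1]
  exact (summable_geometric_of_lt_one hr0 hr1).sum_le_tsum _ fun i _ => by positivity

/-- For a `(c,α)`-mixed Hölder `f`, writing `f_k^j := f(x_k, y_j)` for centers of the
dyadic intervals containing `x`, `y`, there is `C > 0` depending only on `c` and `α` with
`∑_{j=1}^m ∑_{k=m−j+1}^m |f_k^j − f_{k−1}^j − f_k^{j−1} + f_{k−1}^{j−1}| ≤ C·m·2^{−αm}`,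
and each individual term is at most `C·2^{−α(j+k)}`. -/
theorem telescoping_tail_bound (c α : ℝ) (hc : 0 < c) (hα : 0 < α) (hα1 : α ≤ 1) :
    ∃ C > 0, ∀ f : ℝ × ℝ → ℝ, MixedHolder c α f → ∀ m : ℕ, 1 ≤ m →
      ∀ x ∈ Set.Icc (0:ℝ) 1, ∀ y ∈ Set.Icc (0:ℝ) 1,
        ((∑ j ∈ Finset.Icc 1 m, ∑ k ∈ Finset.Icc (m - j + 1) m,
            |f (dyadicCenter k x, dyadicCenter j y) - f (dyadicCenter (k - 1) x, dyadicCenter j y)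
              - f (dyadicCenter k x, dyadicCenter (j - 1) y)
              + f (dyadicCenter (k - 1) x, dyadicCenter (j - 1) y)|) ≤
          C * m * (2 : ℝ) ^ (-(α * (m : ℝ)))) ∧
        ∀ j ∈ Finset.Icc 1 m, ∀ k ∈ Finset.Icc 1 m,
          |f (dyadicCenter k x, dyadicCenter j y) - f (dyadicCenter (k - 1) x, dyadicCenter j y)
              - f (dyadicCenter k x, dyadicCenter (j - 1) y)
              + f (dyadicCenter (k - 1) x, dyadicCenter (j - 1) y)| ≤
            C * (2 : ℝ) ^ (-(α * ((j : ℝ) + (k : ℝ)))) := by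
  have hr1 : (2 : ℝ) ^ (-α) < 1 := Real.rpow_lt_one_of_one_lt_of_neg one_lt_two (by linarith)
  have hr0 : (0 : ℝ) < (2 : ℝ) ^ (-α) := by positivity
  have hS : 1 ≤ (1 - (2 : ℝ) ^ (-α))⁻¹ := (one_le_inv₀ (by linarith)).2 (by linarith)
  refine ⟨4 * c * (1 - (2 : ℝ) ^ (-α))⁻¹, by positivity, fun f hf m _ x hx y hy => ⟨?_, ?_⟩⟩
  · have hrow (j : ℕ) (hj : j ∈ Finset.Icc 1 m) := by
      obtain ⟨hj1, hjm⟩ := Finset.mem_Icc.1 hj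
      exact (Finset.sum_le_sum fun k hk => hf.abs_mixed_difference_le hc hα hα1 hj1
        ((Nat.le_add_left 1 (m - j)).trans (Finset.mem_Icc.1 hk).1) hx hy).trans
        ((Finset.mul_sum _ _ _).symm.trans_le
          (mul_le_mul_of_nonneg_left (sum_Icc_two_rpow_le hα hjm) (by positivity)))
    refine (Finset.sum_le_sum hrow).trans_eq ?_
    rw [Finset.sum_const, Nat.card_Icc, nsmul_eq_mul, Nat.add_sub_cancel]
    ring
  · intro j hj k hk
    refine (hf.abs_mixed_difference_le hc hα hα1 (Finset.mem_Icc.1 hj).1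
      (Finset.mem_Icc.1 hk).1 hx hy).trans ?_
    exact mul_le_mul_of_nonneg_right (le_mul_of_one_le_right (by positivity) hS) (by positivity)

end
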